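/- Let m ≥ 1 and a, b_1,…,b_m, c_1,…,c_m ∈ ℂ with a ≠ 0, β_{0,i} = b_i ≠ 0, β_{1,i} = c_i − 1 − b_i ≠ 0 for all i, γ_w = a − Σ_i w_i c_i + |w| ≠ 0 for all w ∈ {0,1}^m, and fix k with c_k ≠ 1. With C the {0,1}^m-indexed intersection matrix C_{v,v'} = Σ_w A_w ∏_{i: w_i=0} δ(v_i,v'_i)/β_{v_i,i} (A_w the chain sum, A_{(0,…,0)} = 1), (e_v) the standard row basis, f_v = ((a − Σβ_v)/a) e_v − Σ_j (β_{1−v_j,j}/a) e_{σ_j·v}, and Πβ_v = ∏_i β_{v_i,i}, define the 2^m × 2^m matrix Π_k = Σ_{v∈{0,1}^m, v_k=0} (β_{1,k}·Πβ_v/(β_{0,k}+β_{1,k}))·(C·(f_v − f_{σ_k·v})ᵀ)·(e_v − e_{σ_k·v}) (outer products of a column and a row vector), acting on row vectors by z ↦ z·Π_k. Then for every v with v_k = 0: (e_v − e_{σ_k·v})·Π_k = e_v − e_{σ_k·v} and (β_{0,k} e_v + β_{1,k} e_{σ_k·v})·Π_k = 0; consequently Π_k² = Π_k, i.e. Π_k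 is the projection onto the span of {e_v − e_{σ_k·v} : v_k = 0} along the span of {β_{0,k} e_v + β_{1,k} e_{σ_k·v} : v_k = 0}. -/

import Mathlib

open Finset
open scoped Classical

/-- `v_i ∈ {0,1}` regarded as a complex number. -/
noncomputable def bval (s : Bool) : ℂ := if s then 1 else 0

/-- The parameters `β_{0,i} = b_i`, `β_{1,i} = c_i − 1 − b_i`. -/
noncomputable def betaP {m : ℕ} (b c : Fin m → ℂ) (s : Bool) (i : Fin m) : ℂ :=
  if s then c i - 1 - b i else b i

/-- `σ_k·v` : flip the `k`-th coordinate of `v`. -/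
def flipv {m : ℕ} (k : Fin m) (v : Fin m → Bool) : Fin m → Bool :=
  Function.update v k (!(v k))

/-- The weight `|v| = Σ v_i` of `v ∈ {0,1}^m`. -/
def wt {m : ℕ} (v : Fin m → Bool) : ℕ := ∑ i, if v i then 1 else 0

/-- `γ_w = a − Σ_i w_i c_i + |w|`. -/
noncomputable def gammaP {m : ℕ} (a : ℂ) (c : Fin m → ℂ) (w : Fin m → Bool) : ℂ :=
  a - ∑ i, (if w i then c i else 0) + (wt w : ℂ)

/-- `A_w = Σ ∏_{j=1}^r 1/γ_{w^{(j)}}`, the sum over all chains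
`w = w^{(r)} ≻ w^{(r−1)} ≻ ⋯ ≻ w^{(1)}` with `|w^{(j)}| = j` (here `r = |w|`;
a chain is encoded as `ch : Fin r → {0,1}^m` with `ch j = w^{(j+1)}`, the conditions
on weights making the inclusions automatically strict);
for `w = (0,…,0)` the empty chain gives `A_w = 1`. -/
noncomputable def Aw {m : ℕ} (γ : (Fin m → Bool) → ℂ) (w : Fin m → Bool) : ℂ :=
  ∑ ch ∈ (univ : Finset (Fin (wt w) → Fin m → Bool)).filter
      (fun ch =>
        (∀ j : Fin (wt w), wt (ch j) = j.val + 1) ∧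
        (∀ j : Fin (wt w), j.val = wt w - 1 → ch j = w) ∧
        (∀ j j' : Fin (wt w), j'.val = j.val + 1 →
          ∀ i, ch j i = true → ch j' i = true)),
    ∏ j, 1 / γ (ch j)

/-- The intersection matrix `C` with entries
`C_{v,v'} = Σ_w A_w · ∏_{i : w_i = 0} δ(v_i, v'_i)/β_{v_i,i}`. -/
noncomputable def Cmat {m : ℕ} (a : ℂ) (b c : Fin m → ℂ) :
    Matrix (Fin m → Bool) (Fin m → Bool) ℂ :=
  fun v v' => ∑ w, Aw (gammaP a c) w *
    ∏ i ∈ univ.filter (fun i => w i = false),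
      (if v i = v' i then 1 else 0) / betaP b c (v i) i

/-- `Σβ_v = Σ_i β_{v_i,i}`. -/
noncomputable def Sbeta {m : ℕ} (b c : Fin m → ℂ) (v : Fin m → Bool) : ℂ :=
  ∑ i, betaP b c (v i) i

/-- `Πβ_v = ∏_i β_{v_i,i}`. -/
noncomputable def Pbeta {m : ℕ} (b c : Fin m → ℂ) (v : Fin m → Bool) : ℂ :=
  ∏ i, betaP b c (v i) i

/-- The standard basis row vector `e_v` of `ℂ^{2^m}`, `(e_v)_w = δ_{v,w}`. -/
noncomputable def evec {m : ℕ} (v : Fin m → Bool) : (Fin m → Bool) → ℂ :=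
  fun w => if w = v then 1 else 0

/-- The coordinate row vector `f_v = ((a − Σβ_v)/a) e_v − Σ_j (β_{1−v_j,j}/a) e_{σ_j·v}`
of the class `ψ_v` in the frame `(φ_v)`. -/
noncomputable def fvec {m : ℕ} (a : ℂ) (b c : Fin m → ℂ) (v : Fin m → Bool) :
    (Fin m → Bool) → ℂ :=
  ((a - Sbeta b c v) / a) • evec v - ∑ j, (betaP b c (!(v j)) j / a) • evec (flipv j v)

/-- The residue matrix `R_k`: `(R_k)_{v,v} = −β_{v_k,k}`, `(R_k)_{v,σ_k·v} = −β_{1−v_k,k}`,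
all other entries `0`. -/
noncomputable def Rmat {m : ℕ} (b c : Fin m → ℂ) (k : Fin m) :
    Matrix (Fin m → Bool) (Fin m → Bool) ℂ :=
  fun v w =>
    if w = v then -betaP b c (v k) k
    else if w = flipv k v then -betaP b c (!(v k)) k
    else 0

/-- The projection matrix
`Π_k = Σ_{v_k=0} (β_{1,k}·Πβ_v/(β_{0,k}+β_{1,k}))·(C·(f_v − f_{σ_k·v})ᵀ)·(e_v − e_{σ_k·v})`
(outer products of a column and a row vector). -/
noncomputable def Pik {m : ℕ} (a : ℂ) (b c : Fin m → ℂ) (k : Fin m) :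
    Matrix (Fin m → Bool) (Fin m → Bool) ℂ :=
  ∑ v ∈ univ.filter (fun v : Fin m → Bool => v k = false),
    (betaP b c true k * Pbeta b c v / (betaP b c false k + betaP b c true k)) •
      Matrix.vecMulVec
        (fun u => ∑ w, Cmat a b c u w * (fvec a b c v w - fvec a b c (flipv k v) w))
        (evec v - evec (flipv k v))
section FlipWeight

variable {m : ℕ}

lemma flipv_self (k : Fin m) (v : Fin m → Bool) : flipv k v k = !(v k) := by
  simp [flipv]

lemma flipv_of_ne {i k : Fin m} (h : i ≠ k) (v : Fin m → Bool) : flipv k v i = v i := by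
  simp [flipv, h]

lemma flipv_involutive (k : Fin m) : Function.Involutive (flipv k) := by
  intro v
  ext i
  by_cases h : i = k
  · subst h; simp [flipv_self]
  · simp [flipv_of_ne h]

lemma flipv_left_injective (v : Fin m → Bool) {i j : Fin m} (h : flipv i v = flipv j v) :
    i = j := by
  by_contra hij
  have := congrFun h i
  rw [flipv_self, flipv_of_ne hij] at this
  simp at this

lemma wt_flipv {w : Fin m → Bool} {j : Fin m} (hj : w j = true) :
    wt (flipv j w) + 1 = wt w := by
  unfold wt
  rw [← Finset.add_sum_erase univ _ (mem_univ j),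
    ← Finset.add_sum_erase (f := fun i => if w i then 1 else 0) univ (mem_univ j)]
  have : ∑ x ∈ univ.erase j, (if flipv j w x then 1 else 0)
      = ∑ x ∈ univ.erase j, (if w x then 1 else 0) :=
    Finset.sum_congr rfl fun x hx => by rw [flipv_of_ne (Finset.ne_of_mem_erase hx)]
  rw [this]
  simp [flipv_self, hj, add_comm]

lemma wt_eq_zero {w : Fin m → Bool} : wt w = 0 ↔ w = fun _ => false := by
  simp [wt, funext_iff]

lemma eq_of_le_of_wt_eq {y w : Fin m → Bool} (hle : ∀ i, y i = true → w i = true)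
    (h : wt y = wt w) : y = w := by
  have hle' : ∀ i ∈ univ, (if y i then 1 else 0) ≤ if w i then 1 else 0 := by
    intro i _
    have := hle i
    cases hy : y i <;> simp_all
  have := (Finset.sum_eq_sum_iff_of_le hle').1 h
  ext i
  have := this i (mem_univ i)
  cases hy : y i <;> cases hw : w i <;> simp_all

lemma exists_flipv_eq {y w : Fin m → Bool} (hle : ∀ i, y i = true → w i = true)
    (h : wt y + 1 = wt w) : ∃ j, w j = true ∧ y = flipv j w := by
  obtain ⟨j, hw, hy⟩ : ∃ j, w j = true ∧ y j = false := by
    by_contra! hcon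
    have : y = w := by
      ext i
      have := hle i
      have := hcon i
      cases hy : y i <;> cases hw : w i <;> simp_all
    rw [this] at h
    omega
  refine ⟨j, hw, eq_of_le_of_wt_eq ?_ ?_⟩
  · intro i hi
    have hij : i ≠ j := by rintro rfl; simp [hy] at hi
    rw [flipv_of_ne hij]
    exact hle i hi
  · have := wt_flipv hw
    omega

end FlipWeight

section Chains

variable {m : ℕ}

/-- `ch` is a chain of length `n` ending at `w`, its `j`-th term having weight `j + 1`. -/
def IsChainTo (n : ℕ) (w : Fin m → Bool) (ch : Fin n → Fin m → Bool) : Prop :=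
  (∀ j : Fin n, wt (ch j) = j.val + 1) ∧
  (∀ j : Fin n, j.val = n - 1 → ch j = w) ∧
  (∀ j j' : Fin n, j'.val = j.val + 1 → ∀ i, ch j i = true → ch j' i = true)

lemma Aw_eq_sum_isChainTo (γ : (Fin m → Bool) → ℂ) {w : Fin m → Bool} {n : ℕ} (h : wt w = n) :
    Aw γ w = ∑ ch ∈ (univ : Finset (Fin n → Fin m → Bool)).filter (IsChainTo n w),
      ∏ j, 1 / γ (ch j) := by
  subst h
  unfold Aw IsChainTo
  congr!

lemma Aw_zero (γ : (Fin m → Bool) → ℂ) : Aw γ (fun _ => false) = 1 := by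
  rw [Aw_eq_sum_isChainTo γ (wt_eq_zero.2 rfl), Finset.filter_true_of_mem]
  · simp
  · intro ch _
    exact ⟨fun j => j.elim0, fun j => j.elim0, fun j => j.elim0⟩

lemma IsChainTo.snoc {n : ℕ} {w : Fin m → Bool} {j : Fin m} {ch : Fin n → Fin m → Bool}
    (hw : wt w = n + 1) (hj : w j = true) (h : IsChainTo n (flipv j w) ch) :
    IsChainTo (n + 1) w (Fin.snoc (α := fun _ => Fin m → Bool) ch w) := by
  obtain ⟨h1, h2, h3⟩ := h
  refine ⟨?_, ?_, ?_⟩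
  · intro i
    induction i using Fin.lastCases with
    | last => simpa using hw
    | cast i => simpa using h1 i
  · intro i hi
    have : i = Fin.last n := Fin.ext (by simpa using hi)
    subst this
    simp
  · intro i i' hii
    induction i using Fin.lastCases with
    | last => have := i'.isLt; simp at hii; omega
    | cast i =>
      induction i' using Fin.lastCases with
      | last =>
        have hi := h2 i (by simp at hii; omega)
        intro l hl
        simp only [Fin.snoc_castSucc, Fin.snoc_last] at hl ⊢
        rw [hi] at hl
        by_cases hlj : l = j
        · rw [hlj, hj]
        · rwa [flipv_of_ne hlj] at hl
      | cast i' => simpa using h3 i i' (by simpa using hii)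

lemma IsChainTo.exists_init {n : ℕ} {w : Fin m → Bool} {ch : Fin (n + 1) → Fin m → Bool}
    (hw : wt w = n + 1) (h : IsChainTo (n + 1) w ch) :
    ∃ j, w j = true ∧ IsChainTo n (flipv j w) (fun i => ch i.castSucc) := by
  obtain ⟨h1, h2, h3⟩ := h
  have hlast : ch (Fin.last n) = w := h2 _ (by simp)
  have key : ∃ j, w j = true ∧ ∀ i : Fin n, i.val = n - 1 → ch i.castSucc = flipv j w := by
    rcases Nat.eq_zero_or_pos n with rfl | hn
    · obtain ⟨j, hj, -⟩ := exists_flipv_eq (y := fun _ => false) (w := w) (by simp)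
        (by rw [hw, wt_eq_zero.2 rfl])
      exact ⟨j, hj, fun i => i.elim0⟩
    · let p : Fin n := ⟨n - 1, by omega⟩
      obtain ⟨j, hj, hp⟩ := exists_flipv_eq (y := ch p.castSucc) (w := w)
        (by
          rw [← hlast]
          exact h3 _ _ (by simp [p]; omega))
        (by rw [hw, h1]; simp [p]; omega)
      refine ⟨j, hj, fun i hi => ?_⟩
      have : i = p := Fin.ext hi
      rw [this, hp]
  obtain ⟨j, hj, hl⟩ := key
  exact ⟨j, hj, fun i => by simpa using h1 i.castSucc, hl,
    fun i i' hii => h3 _ _ (by simpa using hii)⟩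

lemma IsChainTo.flipv_unique {n : ℕ} {w : Fin m → Bool} {i j : Fin m}
    {ch : Fin n → Fin m → Bool} (hw : wt w = n + 1) (hi : w i = true) (hj : w j = true)
    (h : IsChainTo n (flipv i w) ch) (h' : IsChainTo n (flipv j w) ch) : i = j := by
  apply flipv_left_injective w
  have hwi := wt_flipv hi
  have hwj := wt_flipv hj
  rcases Nat.eq_zero_or_pos n with rfl | hn
  · rw [wt_eq_zero.1 (show wt (flipv i w) = 0 by omega),
      wt_eq_zero.1 (show wt (flipv j w) = 0 by omega)]
  · rw [← h.2.1 ⟨n - 1, by omega⟩ rfl, h'.2.1 ⟨n - 1, by omega⟩ rfl]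

/-- Removing the top element of a chain gives the recursion for the chain sums. -/
lemma Aw_recursion {γ : (Fin m → Bool) → ℂ} {w : Fin m → Bool} (hγ : γ w ≠ 0)
    (hw : w ≠ fun _ => false) :
    γ w * Aw γ w = ∑ j ∈ univ.filter (fun j => w j = true), Aw γ (flipv j w) := by
  obtain ⟨n, hn⟩ := Nat.exists_eq_succ_of_ne_zero (mt wt_eq_zero.1 hw)
  have hR : ∑ j ∈ univ.filter (fun j => w j = true), Aw γ (flipv j w)
      = ∑ j ∈ univ.filter (fun j => w j = true),
        ∑ ch ∈ (univ : Finset (Fin n → Fin m → Bool)).filter (IsChainTo n (flipv j w)),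
          ∏ i, 1 / γ (ch i) := by
    refine Finset.sum_congr rfl fun j hj => Aw_eq_sum_isChainTo γ ?_
    have := wt_flipv (mem_filter.1 hj).2
    omega
  rw [hR, Aw_eq_sum_isChainTo γ hn, Finset.mul_sum, Finset.sum_sigma']
  symm
  refine Finset.sum_bij (fun p _ => Fin.snoc (α := fun _ => Fin m → Bool) p.2 w) ?_ ?_ ?_ ?_
  · rintro ⟨j, ch⟩ hp
    simp only [mem_sigma, mem_filter, mem_univ, true_and] at hp ⊢
    exact hp.2.snoc hn hp.1
  · rintro ⟨j, ch⟩ hp ⟨j', ch'⟩ hp' heq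
    simp only [mem_sigma, mem_filter, mem_univ, true_and] at hp hp'
    obtain rfl : ch = ch' := by
      have := congrArg (Fin.init (α := fun _ => Fin m → Bool)) heq
      simpa using this
    obtain rfl := hp.2.flipv_unique hn hp.1 hp'.1 hp'.2
    rfl
  · intro ch hch
    simp only [mem_filter, mem_univ, true_and] at hch
    obtain ⟨j, hj, hc⟩ := hch.exists_init hn
    refine ⟨⟨j, fun i => ch i.castSucc⟩, by simpa using ⟨hj, hc⟩, ?_⟩
    have hlast : ch (Fin.last n) = w := hch.2.1 _ (by simp)
    rw [← hlast]
    exact Fin.snoc_init_self (α := fun _ => Fin m → Bool) ch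
  · rintro ⟨j, ch⟩ _
    simp only [Fin.prod_univ_castSucc, Fin.snoc_castSucc, Fin.snoc_last]
    field_simp

end Chains

section Duality

variable {m : ℕ}

/-- The product `∏_{i : w_i = 0} δ(u_i, v_i)/β_{u_i,i}`. -/
noncomputable def deltaProd (b c : Fin m → ℂ) (w u v : Fin m → Bool) : ℂ :=
  ∏ i ∈ univ.filter (fun i => w i = false), (if u i = v i then 1 else 0) / betaP b c (u i) i

lemma deltaProd_eq_mul_erase (b c : Fin m → ℂ) (w u v : Fin m → Bool) (j : Fin m) :
    deltaProd b c w u v =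
      (if w j = false then (if u j = v j then 1 else 0) / betaP b c (u j) j else 1) *
      ∏ i ∈ univ.erase j,
        if w i = false then (if u i = v i then 1 else 0) / betaP b c (u i) i else 1 := by
  rw [deltaProd, Finset.prod_filter]
  exact (Finset.mul_prod_erase univ _ (mem_univ j)).symm

lemma deltaProd_flipv_right (b c : Fin m → ℂ) {w : Fin m → Bool} (u v : Fin m → Bool)
    {j : Fin m} (hj : w j = true) :
    deltaProd b c w u (flipv j v) = deltaProd b c w u v := by
  refine Finset.prod_congr rfl fun i hi => ?_
  have hij : i ≠ j := by
    rintro rfl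
    simp [hj] at hi
  rw [flipv_of_ne hij]

lemma betaP_add_betaP_not (b c : Fin m → ℂ) (s : Bool) (i : Fin m) :
    betaP b c s i + betaP b c (!s) i = c i - 1 := by
  cases s <;> simp [betaP]

lemma deltaProd_add_flipv (b c : Fin m → ℂ) (hβ : ∀ s i, betaP b c s i ≠ 0)
    {w : Fin m → Bool} (u v : Fin m → Bool) {j : Fin m} (hj : w j = false) :
    betaP b c (v j) j * deltaProd b c w u v
      + betaP b c (!(v j)) j * deltaProd b c w u (flipv j v)
      = deltaProd b c (flipv j w) u v := by
  have h1 : ∏ i ∈ univ.erase j, (if w i = false then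
        (if u i = flipv j v i then 1 else 0) / betaP b c (u i) i else 1)
      = ∏ i ∈ univ.erase j, if w i = false then
        (if u i = v i then 1 else 0) / betaP b c (u i) i else 1 :=
    Finset.prod_congr rfl fun i hi => by rw [flipv_of_ne (Finset.ne_of_mem_erase hi)]
  have h2 : ∏ i ∈ univ.erase j, (if flipv j w i = false then
        (if u i = v i then 1 else 0) / betaP b c (u i) i else 1)
      = ∏ i ∈ univ.erase j, if w i = false then
        (if u i = v i then 1 else 0) / betaP b c (u i) i else 1 :=
    Finset.prod_congr rfl fun i hi => by rw [flipv_of_ne (Finset.ne_of_mem_erase hi)]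
  rw [deltaProd_eq_mul_erase b c w u v j, deltaProd_eq_mul_erase b c w u (flipv j v) j,
    deltaProd_eq_mul_erase b c (flipv j w) u v j, h1, h2, flipv_self, flipv_self, hj]
  have ht := hβ true j
  have hf := hβ false j
  cases u j <;> cases v j <;> simp [ht, hf]

lemma gammaP_eq_sub_sum (a : ℂ) (c : Fin m → ℂ) (w : Fin m → Bool) :
    gammaP a c w = a - ∑ i, if w i then c i - 1 else 0 := by
  have : ∑ i, (if w i then c i - 1 else 0)
      = ∑ i, (if w i then c i else 0) - ∑ i, (if w i then (1 : ℂ) else 0) := by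
    rw [← Finset.sum_sub_distrib]
    refine Finset.sum_congr rfl fun i _ => ?_
    split_ifs <;> simp
  rw [this, gammaP, wt]
  push_cast
  ring

lemma sum_flip_deltaProd (a : ℂ) (b c : Fin m → ℂ) (hβ : ∀ s i, betaP b c s i ≠ 0)
    (w u v : Fin m → Bool) :
    (a - Sbeta b c v) * deltaProd b c w u v
        - ∑ j, betaP b c (!(v j)) j * deltaProd b c w u (flipv j v)
      = gammaP a c w * deltaProd b c w u v
        - ∑ j, if w j = false then deltaProd b c (flipv j w) u v else 0 := by
  rw [gammaP_eq_sub_sum, Sbeta, sub_mul, sub_mul, Finset.sum_mul, Finset.sum_mul, sub_sub, sub_sub,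
    ← Finset.sum_add_distrib, ← Finset.sum_add_distrib]
  congr 1
  refine Finset.sum_congr rfl fun j _ => ?_
  cases hj : w j
  · simpa using deltaProd_add_flipv b c hβ u v hj
  · rw [deltaProd_flipv_right b c u v hj, ← add_mul, betaP_add_betaP_not]
    simp

lemma sum_mul_evec (g : (Fin m → Bool) → ℂ) (v : Fin m → Bool) :
    ∑ x, g x * evec v x = g v := by
  simp [evec]

lemma sum_mul_fvec (a : ℂ) (b c : Fin m → ℂ) (g : (Fin m → Bool) → ℂ) (v : Fin m → Bool) :
    ∑ x, g x * fvec a b c v x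
      = ((a - Sbeta b c v) * g v - ∑ j, betaP b c (!(v j)) j * g (flipv j v)) / a := by
  have : ∀ x, g x * fvec a b c v x = (a - Sbeta b c v) / a * (g x * evec v x)
      - ∑ j, betaP b c (!(v j)) j / a * (g x * evec (flipv j v) x) := by
    intro x
    simp only [fvec, Pi.sub_apply, Pi.smul_apply, Finset.sum_apply, smul_eq_mul, mul_sub,
      Finset.mul_sum]
    congr 1
    · ring
    · exact Finset.sum_congr rfl fun j _ => by ring
  simp only [this]
  rw [Finset.sum_sub_distrib, Finset.sum_comm]
  simp only [← Finset.mul_sum, sum_mul_evec]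
  rw [sub_div (_ * _), Finset.sum_div, mul_div_right_comm]
  congr 1
  exact Finset.sum_congr rfl fun j _ => by ring

/-- The classes `ψ_v` are dual to the `φ_v`, up to the factor `1/Πβ_v`. -/
lemma sum_Cmat_mul_fvec {a : ℂ} {b c : Fin m → ℂ} (ha : a ≠ 0)
    (hβ : ∀ s i, betaP b c s i ≠ 0) (hγ : ∀ w : Fin m → Bool, gammaP a c w ≠ 0)
    (u v : Fin m → Bool) :
    ∑ x, Cmat a b c u x * fvec a b c v x = evec v u / Pbeta b c v := by
  have hC : ∀ x, Cmat a b c u x = ∑ w, Aw (gammaP a c) w * deltaProd b c w u x := fun _ => rfl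
  have hterm : ∀ w, Aw (gammaP a c) w * ((a - Sbeta b c v) * deltaProd b c w u v
        - ∑ j, betaP b c (!(v j)) j * deltaProd b c w u (flipv j v))
      = gammaP a c w * Aw (gammaP a c) w * deltaProd b c w u v
        - ∑ j, if w j = false then
          Aw (gammaP a c) w * deltaProd b c (flipv j w) u v else 0 := by
    intro w
    rw [sum_flip_deltaProd a b c hβ, mul_sub, Finset.mul_sum]
    congr 1
    · ring
    · exact Finset.sum_congr rfl fun j _ => by split_ifs <;> simp
  have hswap : ∑ w : Fin m → Bool, ∑ j, (if w j = false then
        Aw (gammaP a c) w * deltaProd b c (flipv j w) u v else 0)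
      = ∑ w : Fin m → Bool,
        (∑ j ∈ univ.filter (fun j => w j = true), Aw (gammaP a c) (flipv j w))
          * deltaProd b c w u v := by
    simp only [Finset.sum_mul, Finset.sum_filter]
    rw [Finset.sum_comm]
    conv_rhs => rw [Finset.sum_comm]
    refine Finset.sum_congr rfl fun j _ => ?_
    rw [← Equiv.sum_comp (flipv_involutive j).toPerm]
    refine Finset.sum_congr rfl fun w _ => ?_
    simp only [Function.Involutive.coe_toPerm, flipv_involutive j w, flipv_self]
    cases w j <;> simp
  have hzero : deltaProd b c (fun _ => false) u v = evec v u / Pbeta b c v := by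
    unfold deltaProd Pbeta evec
    by_cases huv : u = v
    · subst huv
      simp
    · obtain ⟨i, hi⟩ := Function.ne_iff.1 huv
      rw [if_neg huv, zero_div]
      exact Finset.prod_eq_zero (i := i) (by simp) (by simp [hi])
  rw [sum_mul_fvec]
  simp only [hC]
  have hsum : (a - Sbeta b c v) * ∑ w, Aw (gammaP a c) w * deltaProd b c w u v
        - ∑ j, betaP b c (!(v j)) j *
          ∑ w, Aw (gammaP a c) w * deltaProd b c w u (flipv j v)
      = ∑ w, Aw (gammaP a c) w * ((a - Sbeta b c v) * deltaProd b c w u v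
        - ∑ j, betaP b c (!(v j)) j * deltaProd b c w u (flipv j v)) := by
    simp only [mul_sub, Finset.mul_sum, Finset.sum_sub_distrib]
    conv_rhs => rw [Finset.sum_comm (s := univ (α := Fin m → Bool))]
    congr 1
    · exact Finset.sum_congr rfl fun w _ => by ring
    · exact Finset.sum_congr rfl fun j _ => Finset.sum_congr rfl fun w _ => by ring
  rw [hsum]
  simp only [hterm]
  rw [Finset.sum_sub_distrib, hswap, ← Finset.sum_sub_distrib,
    Finset.sum_eq_single (fun _ => false)]
  · have h0 : gammaP a c (fun _ : Fin m => false) = a := by simp [gammaP_eq_sub_sum]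
    rw [Aw_zero, h0, hzero]
    simp [ha]
  · intro w _ hw
    rw [Aw_recursion (hγ w) hw, sub_self]
  · simp

end Duality

lemma Pbeta_mul_betaP_not {m : ℕ} (b c : Fin m → ℂ) (v : Fin m → Bool) (k : Fin m) :
    Pbeta b c v * betaP b c (!(v k)) k = Pbeta b c (flipv k v) * betaP b c (v k) k := by
  unfold Pbeta
  rw [← Finset.mul_prod_erase univ _ (mem_univ k),
    ← Finset.mul_prod_erase univ (fun i => betaP b c (flipv k v i) i) (mem_univ k)]
  have : ∏ i ∈ univ.erase k, betaP b c (flipv k v i) i = ∏ i ∈ univ.erase k, betaP b c (v i) i :=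
    Finset.prod_congr rfl fun i hi => by rw [flipv_of_ne (Finset.ne_of_mem_erase hi)]
  rw [this, flipv_self]
  ring

section Projection

variable {m : ℕ} {a : ℂ} {b c : Fin m → ℂ}

lemma evec_vecMul_Pik (ha : a ≠ 0) (hβ : ∀ s i, betaP b c s i ≠ 0)
    (hγ : ∀ w : Fin m → Bool, gammaP a c w ≠ 0) (k : Fin m) (u : Fin m → Bool) :
    Matrix.vecMul (evec u) (Pik a b c k)
      = ∑ v ∈ univ.filter (fun v : Fin m → Bool => v k = false),
        (betaP b c true k * Pbeta b c v / (betaP b c false k + betaP b c true k)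
          * (evec v u / Pbeta b c v - evec (flipv k v) u / Pbeta b c (flipv k v)))
          • (evec v - evec (flipv k v)) := by
  have hu : Matrix.vecMul (evec u) (Pik a b c k) = Pik a b c k u := by
    ext x
    simp [Matrix.vecMul, dotProduct, evec]
  rw [hu]
  ext x
  simp only [Pik, mul_sub, Finset.sum_sub_distrib, sum_Cmat_mul_fvec ha hβ hγ, Matrix.sum_apply,
    Matrix.smul_apply, Matrix.vecMulVec_apply, Finset.sum_apply, Pi.smul_apply, smul_eq_mul]
  exact Finset.sum_congr rfl fun v _ => by ring

lemma Pbeta_ne_zero (hβ : ∀ s i, betaP b c s i ≠ 0) (v : Fin m → Bool) : Pbeta b c v ≠ 0 :=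
  Finset.prod_ne_zero_iff.2 fun i _ => hβ _ i

lemma flipv_ne_of_eq {k : Fin m} {u v : Fin m → Bool} (h : u k = v k) : u ≠ flipv k v := by
  rintro rfl
  simp [flipv_self] at h

lemma evec_vecMul_Pik_of_eq_false (ha : a ≠ 0) (hβ : ∀ s i, betaP b c s i ≠ 0)
    (hγ : ∀ w : Fin m → Bool, gammaP a c w ≠ 0) {k : Fin m} {v : Fin m → Bool}
    (hv : v k = false) :
    Matrix.vecMul (evec v) (Pik a b c k)
      = (betaP b c true k / (betaP b c false k + betaP b c true k))
        • (evec v - evec (flipv k v)) := by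
  rw [evec_vecMul_Pik ha hβ hγ, Finset.sum_eq_single v]
  · have := Pbeta_ne_zero hβ v
    congr 1
    simp only [evec, if_true, if_neg (flipv_ne_of_eq (rfl : v k = v k))]
    field_simp
    ring
  · intro x hx hxv
    have hxk : v k = x k := by rw [hv, (mem_filter.1 hx).2]
    simp [evec, hxv.symm, flipv_ne_of_eq hxk]
  · simp [hv]

lemma evec_flipv_vecMul_Pik_of_eq_false (ha : a ≠ 0) (hβ : ∀ s i, betaP b c s i ≠ 0)
    (hγ : ∀ w : Fin m → Bool, gammaP a c w ≠ 0) {k : Fin m} {v : Fin m → Bool}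
    (hv : v k = false) :
    Matrix.vecMul (evec (flipv k v)) (Pik a b c k)
      = (-(betaP b c false k / (betaP b c false k + betaP b c true k)))
        • (evec v - evec (flipv k v)) := by
  rw [evec_vecMul_Pik ha hβ hγ, Finset.sum_eq_single v]
  · have h1 := Pbeta_ne_zero hβ (flipv k v)
    have h2 := Pbeta_mul_betaP_not b c v k
    rw [hv, Bool.not_false] at h2
    congr 1
    simp only [evec, if_true, if_neg (flipv_ne_of_eq (rfl : v k = v k)).symm]
    rw [mul_comm (betaP b c true k), h2]
    field_simp
    ring
  · intro x hx hxv
    have hxk : v k = x k := by rw [hv, (mem_filter.1 hx).2]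
    have h1 : flipv k v ≠ x := (flipv_ne_of_eq hxk.symm).symm
    have h2 : flipv k v ≠ flipv k x := fun h => hxv ((flipv_involutive k).injective h).symm
    simp [evec, h1, h2]
  · simp [hv]

end Projection

/-- **Lemma 4.7.** For every `v` with `v_k = 0`:
`(e_v − e_{σ_k·v})·Π_k = e_v − e_{σ_k·v}` and
`(β_{0,k} e_v + β_{1,k} e_{σ_k·v})·Π_k = 0`; consequently `Π_k² = Π_k`. -/
theorem stmt_13 (m : ℕ) (hm : 1 ≤ m) (a : ℂ) (b c : Fin m → ℂ) (ha : a ≠ 0)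
    (hb0 : ∀ i, betaP b c false i ≠ 0) (hb1 : ∀ i, betaP b c true i ≠ 0)
    (hγ : ∀ w : Fin m → Bool, gammaP a c w ≠ 0) (k : Fin m) (hck : c k ≠ 1) :
    (∀ v : Fin m → Bool, v k = false →
      Matrix.vecMul (evec v - evec (flipv k v)) (Pik a b c k) =
        evec v - evec (flipv k v) ∧
      Matrix.vecMul (betaP b c false k • evec v + betaP b c true k • evec (flipv k v))
          (Pik a b c k) = 0) ∧
    Pik a b c k * Pik a b c k = Pik a b c k := by
  have hβ : ∀ s i, betaP b c s i ≠ 0 := by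
    rintro (_ | _) i
    exacts [hb0 i, hb1 i]
  have hs : betaP b c false k + betaP b c true k ≠ 0 := by
    rw [show true = !false from rfl, betaP_add_betaP_not]
    exact sub_ne_zero.2 hck
  have hfix : ∀ v : Fin m → Bool, v k = false →
      Matrix.vecMul (evec v - evec (flipv k v)) (Pik a b c k) = evec v - evec (flipv k v) := by
    intro v hv
    rw [Matrix.sub_vecMul, evec_vecMul_Pik_of_eq_false ha hβ hγ hv,
      evec_flipv_vecMul_Pik_of_eq_false ha hβ hγ hv, ← sub_smul, sub_neg_eq_add, ← add_div,
      add_comm, div_self hs, one_smul]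
  refine ⟨fun v hv => ⟨hfix v hv, ?_⟩, ?_⟩
  · rw [Matrix.add_vecMul, Matrix.smul_vecMul, Matrix.smul_vecMul,
      evec_vecMul_Pik_of_eq_false ha hβ hγ hv, evec_flipv_vecMul_Pik_of_eq_false ha hβ hγ hv,
      smul_smul, smul_smul, ← add_smul]
    convert zero_smul ℂ _ using 2
    ring
  · conv_lhs => enter [1]; unfold Pik
    rw [Finset.sum_mul]
    conv_rhs => unfold Pik
    refine Finset.sum_congr rfl fun v hv => ?_
    rw [Matrix.smul_mul, Matrix.vecMulVec_mul, hfix v (mem_filter.1 hv).2]
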